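/- Assume N = 3 and χ_σ^ω = χ_σ for all ω ∈ W_0. Then: (1) for (a_1,a_2) ∈ S_{Id}: f_{Id,(a_1,a_2)}|(T_γ T_{ω_1})² = f_{Id,(a_1−1,a_2)} = f_{Id,(a_1,a_2)}|T_{t_{(−1,0)}} and f_{Id,(a_1,a_2)}|(T_γ T_{ω_1} T_γ)² = f_{Id,(a_1−1,a_2−1)} = f_{Id,(a_1,a_2)}|T_{t_{(−1,−1)}}; (2) for (a_1,a_2) ∈ S_{ω_1}, with f = f_{ω_1,(a_1,a_2)}: f|(T_{ω_1} T_γ)² = f_{ω_1,(a_1,a_2−1)} = f|T_{t_{(0,−1)}} and f|(T_γ T_{ω_1} T_γ)² = f_{ω_1,(a_1−1,a_2−1)} = f|T_{t_{(−1,−1)}}; (3) for (a_1,a_2) ∈ S_{ω_1ω_2}, with f = f_{ω_1ω_2,(a_1,a_2)}: f|(T_{ω_1} T_γ²)² = f_{ω_1ω_2,(a_1+1,a_2)} = f|T_{t_{(1,0)}} and f|(T_γ² T_{ω_1} T_γ²)² = f_{ω_1ω_2,(a_1+1,a_2+1)} = f|T_{t_{(1,1)}}; (4) for (a_1,a_2)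 ∈ S_{ω_2ω_1}, with f = f_{ω_2ω_1,(a_1,a_2)}: f|(T_γ T_{ω_1})² = f_{ω_2ω_1,(a_1−1,a_2)} = f|T_{t_{(−1,0)}} and f|(T_γ² T_{ω_1})² = f_{ω_2ω_1,(a_1,a_2+1)} = f|T_{t_{(0,1)}}; (5) for (a_1,a_2) ∈ S_{ω_2}, with f = f_{ω_2,(a_1,a_2)}: f|(T_{ω_1} T_γ²)² = f_{ω_2,(a_1+1,a_2)} = f|T_{t_{(1,0)}} and f|(T_{ω_1} T_γ)² = f_{ω_2,(a_1,a_2−1)} = f|T_{t_{(0,−1)}}; (6) for (a_1,a_2) ∈ S_{ω_2²}, with f = f_{ω_2²,(a_1,a_2)}: f|(T_γ² T_{ω_1})² = f_{ω_2²,(a_1,a_2+1)} = f|T_{t_{(0,1)}} and f|(T_γ² T_{ω_1} T_γ²)² = f_{ω_2²,(a_1+1,a_2+1)} = f|T_{t_{(1,1)}}. -/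

import Mathlib

open Matrix

noncomputable section

namespace IH

variable (p : ℕ) [Fact p.Prime]

/-- `\bar{𝔽}_p`, an algebraic closure of the residue field. -/
abbrev kb := AlgebraicClosure (ZMod p)

variable (N : ℕ)

/-- `G = GL_N(F)` with `F = ℚ_p`. -/
abbrev GG := GL (Fin N) ℚ_[p]
/-- `GL_N(O_F)` (as an abstract group, mapping onto `K ⊆ G`). -/
abbrev MM := GL (Fin N) ℤ_[p]
/-- `GL_N(k_F)`. -/
abbrev Gk := GL (Fin N) (ZMod p)

/-- The inclusion `GL_N(O_F) → GL_N(F)`. -/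
def iotaM : MM p N →* GG p N := Matrix.GeneralLinearGroup.map (PadicInt.Coe.ringHom)

/-- The reduction map `red : GL_N(O_F) → GL_N(k_F)`. -/
def redM : MM p N →* Gk p N := Matrix.GeneralLinearGroup.map (PadicInt.toZMod)

/-- Elements of `GL_N(O_F)` whose reduction is upper triangular: the Iwahori condition. -/
def Ipre : Set (MM p N) :=
  {m | ∀ i j : Fin N, j < i → ((redM p N m : Matrix (Fin N) (Fin N) (ZMod p)) i j = 0)}

/-- Elements of `GL_N(O_F)` whose reduction is upper triangular unipotent: pro-p Iwahori. -/
def I1pre : Set (MM p N) :=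
  {m | m ∈ Ipre p N ∧ ∀ i : Fin N, ((redM p N m : Matrix (Fin N) (Fin N) (ZMod p)) i i = 1)}

/-- Elements of `GL_N(O_F)` reducing to the identity: `K_1 = ker red`. -/
def K1pre : Set (MM p N) := {m | redM p N m = 1}

/-- `K = GL_N(O_F)` as a subset of `G`. -/
def Kset : Set (GG p N) := Set.range (iotaM p N)
/-- The Iwahori subgroup `I ⊆ G`. -/
def Iset : Set (GG p N) := iotaM p N '' Ipre p N
/-- The pro-p Iwahori subgroup `I_1 ⊆ G`. -/
def I1set : Set (GG p N) := iotaM p N '' I1pre p N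
/-- `K_1 ⊆ G`. -/
def K1set : Set (GG p N) := iotaM p N '' K1pre p N

/-- The uniformizer `ϖ = p` as a unit of `ℚ_p`. -/
def pU : ℚ_[p]ˣ :=
  Units.mk0 (p : ℚ_[p]) (by
    have h := (Fact.out : p.Prime).ne_zero
    exact_mod_cast Nat.cast_ne_zero.mpr h)

/-- Scalar matrices as elements of `G`. -/
def scalarGL (u : ℚ_[p]ˣ) : GG p N :=
  Units.map (algebraMap ℚ_[p] (Matrix (Fin N) (Fin N) ℚ_[p])).toMonoidHom u

/-- The central element `ϖ^n · Id`. -/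
def piSc (n : ℤ) : GG p N := scalarGL p N (pU p ^ n)

/-- Invertible diagonal matrices. -/
def diagGL (d : Fin N → ℚ_[p]ˣ) : GG p N where
  val := Matrix.diagonal fun i => (d i : ℚ_[p])
  inv := Matrix.diagonal fun i => (((d i)⁻¹ : ℚ_[p]ˣ) : ℚ_[p])
  val_inv := by
    rw [Matrix.diagonal_mul_diagonal]
    simp
  inv_val := by
    rw [Matrix.diagonal_mul_diagonal]
    simp

/-- extend `a ∈ ℤ^{N-1}` by `0` in the last coordinate. -/
def expo (a : Fin (N - 1) → ℤ) : Fin N → ℤ :=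
  fun i => if h : (i : ℕ) < N - 1 then a ⟨i, h⟩ else 0

/-- `t_a = diag(ϖ^{a_1}, …, ϖ^{a_{N-1}}, 1)`. -/
def tGL (a : Fin (N - 1) → ℤ) : GG p N :=
  diagGL p N fun i => pU p ^ (expo N a i)

/-- The permutation matrix of `σ` (with `permGL σ · e_j = e_{σ j}`, so that
`permGL` is a group homomorphism). -/
def permGL (σ : Equiv.Perm (Fin N)) : GG p N where
  val := (σ⁻¹).permMatrix ℚ_[p]
  inv := σ.permMatrix ℚ_[p]
  val_inv := by
    show ((σ⁻¹).toPEquiv.toMatrix : Matrix (Fin N) (Fin N) ℚ_[p]) * σ.toPEquiv.toMatrix = 1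
    rw [← PEquiv.toMatrix_trans, ← Equiv.toPEquiv_trans]
    simp only [Equiv.self_trans_symm, Equiv.symm_trans_self, Equiv.Perm.inv_def]
    rw [Equiv.toPEquiv_refl, PEquiv.toMatrix_refl]
  inv_val := by
    show (σ.toPEquiv.toMatrix : Matrix (Fin N) (Fin N) ℚ_[p]) * (σ⁻¹).toPEquiv.toMatrix = 1
    rw [← PEquiv.toMatrix_trans, ← Equiv.toPEquiv_trans]
    simp only [Equiv.self_trans_symm, Equiv.symm_trans_self, Equiv.Perm.inv_def]
    rw [Equiv.toPEquiv_refl, PEquiv.toMatrix_refl]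

/-- `ω t_a`. -/
def wS (σ : Equiv.Perm (Fin N)) (a : Fin (N - 1) → ℤ) : GG p N :=
  permGL p N σ * tGL p N a

/-- The permutation `ω₂` (as a matrix: first row block `(0, I_{N-1})`, last row `(1,0,…,0)`). -/
def w2 : Equiv.Perm (Fin N) := (finRotate N)⁻¹

/-- `γ = ω₂ · diag(ϖ, I_{N-1})`. -/
def gammaGL : GG p N :=
  permGL p N (w2 N) * tGL p N fun i => if (i : ℕ) = 0 then 1 else 0

/-- `S_ω = {a ∈ ℤ^{N-1} : (ω t_a) I (ω t_a)⁻¹ ∩ K ⊆ I}`. -/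
def Sset (σ : Equiv.Perm (Fin N)) : Set (Fin (N - 1) → ℤ) :=
  {a | ∀ g ∈ Iset p N,
    wS p N σ a * g * (wS p N σ a)⁻¹ ∈ Kset p N →
    wS p N σ a * g * (wS p N σ a)⁻¹ ∈ Iset p N}

/-- The unit of `k_F^×` attached to a nonzero element of `k_F` (junk value `1` at `0`). -/
def unitOf (x : ZMod p) : (ZMod p)ˣ :=
  if h : x = 0 then 1 else Units.mk0 x h

/-- The diagonal of the reduction of `m`, as an `N`-tuple of units of `k_F`. -/
def diagOf (m : MM p N) : Fin N → (ZMod p)ˣ :=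
  fun i => unitOf p ((redM p N m : Matrix (Fin N) (Fin N) (ZMod p)) i i)

/-- The transformation rule for functions in `H_{IZ}(χ)`, where the character `χ` of `I`
is given by the character `ξ` of the torus `(k_F^×)^N` through the diagonal of the
reduction, extended to `IZ` by `χ(ϖ) = 1`. -/
def HTransf (ξ : (Fin N → (ZMod p)ˣ) →* (kb p)ˣ) (φ : GG p N → kb p) : Prop :=
  ∀ (n₁ n₂ : ℤ) (m₁ m₂ : MM p N), m₁ ∈ Ipre p N → m₂ ∈ Ipre p N → ∀ g : GG p N,
    φ (piSc p N n₁ * iotaM p N m₁ * g * (piSc p N n₂ * iotaM p N m₂)) =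
      (ξ (diagOf p N m₁) : kb p) * (ξ (diagOf p N m₂) : kb p) * φ g

/-- `φ` is supported on the double coset `IZ x I`. -/
def SuppDouble (φ : GG p N → kb p) (x : GG p N) : Prop :=
  ∀ g : GG p N, φ g ≠ 0 → ∃ (n : ℤ) (m₁ m₂ : MM p N), m₁ ∈ Ipre p N ∧ m₂ ∈ Ipre p N ∧
    g = piSc p N n * iotaM p N m₁ * x * iotaM p N m₂

/-- Membership in `H_{IZ}(χ)`: the transformation rule together with support in
finitely many double cosets `IZ g I`. -/
def HMem (ξ : (Fin N → (ZMod p)ˣ) →* (kb p)ˣ) (φ : GG p N → kb p) : Prop :=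
  HTransf p N ξ φ ∧
  ∃ S : Finset (GG p N), ∀ g : GG p N, φ g ≠ 0 →
    ∃ s ∈ S, ∃ (n : ℤ) (m₁ m₂ : MM p N), m₁ ∈ Ipre p N ∧ m₂ ∈ Ipre p N ∧
      g = piSc p N n * iotaM p N m₁ * s * iotaM p N m₂

section Rep

variable {V : Type} [AddCommGroup V] [Module (kb p) V]

/-- `σ` (here `ρ`) is irreducible. -/
def IsIrred (ρ : Representation (kb p) (Gk p N) V) : Prop :=
  (∃ v : V, v ≠ 0) ∧
  ∀ W : Submodule (kb p) V, (∀ g v, v ∈ W → ρ g v ∈ W) → W = ⊥ ∨ W = ⊤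

/-- Membership in the compact induction `ind_{KZ}^G σ`: left `KZ`-equivariance
(where `ϖ` acts trivially), support in finitely many cosets `KZ g`, and smoothness. -/
def IndMem (ρ : Representation (kb p) (Gk p N) V) (f : GG p N → V) : Prop :=
  (∀ (n : ℤ) (m : MM p N) (g : GG p N),
      f (piSc p N n * iotaM p N m * g) = ρ (redM p N m) (f g)) ∧
  (∃ S : Finset (GG p N), ∀ g : GG p N, f g ≠ 0 →
      ∃ s ∈ S, ∃ (n : ℤ) (m : MM p N), g = piSc p N n * iotaM p N m * s) ∧
  (∃ U : Subgroup (GG p N), IsOpen (U : Set (GG p N)) ∧ ∀ u ∈ U, ∀ g, f (g * u) = f g)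

/-- `f` is invariant under right translation by `I_1`. -/
def IsI1Inv (f : GG p N → V) : Prop :=
  ∀ u ∈ I1set p N, ∀ g, f (g * u) = f g

/-- The defining property of the standard function `f_{ω,a}`: an `I_1`-invariant member of
`ind_{KZ}^G σ` supported on `KZ t_a I_1` with value `v₀` at `ω t_a`. -/
def IsStd (ρ : Representation (kb p) (Gk p N) V) (v₀ : V)
    (σp : Equiv.Perm (Fin N)) (a : Fin (N - 1) → ℤ) (f : GG p N → V) : Prop :=
  IndMem p N ρ f ∧ IsI1Inv p N f ∧
  (∀ g : GG p N, f g ≠ 0 → ∃ (n : ℤ) (m : MM p N) (u : GG p N), u ∈ I1set p N ∧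
      g = piSc p N n * iotaM p N m * tGL p N a * u) ∧
  f (wS p N σp a) = v₀

/-- `R` is a set of representatives for `I_1/(I_1 ∩ g⁻¹ I_1 g)`. -/
def IsRepSet (g : GG p N) (R : Finset (GG p N)) : Prop :=
  (↑R ⊆ I1set p N) ∧
  ∀ x ∈ I1set p N, ∃! r : GG p N, r ∈ R ∧
    (r⁻¹ * x ∈ I1set p N ∧ g * (r⁻¹ * x) * g⁻¹ ∈ I1set p N)

/-- The Hecke operator: `f|T_g = ∑_{r} (r g⁻¹)·f`, where `(h·f)(x) = f(xh)`. -/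
def hk (g : GG p N) (R : Finset (GG p N)) (f : GG p N → V) : GG p N → V :=
  fun x => ∑ r ∈ R, f (x * r * g⁻¹)

end Rep

section Helpers

variable {p}

lemma toZMod_eq_zero_iff (x : ℤ_[p]) : PadicInt.toZMod x = 0 ↔ ‖(x : ℚ_[p])‖ < 1 := by
  rw [← RingHom.mem_ker, PadicInt.ker_toZMod, IsLocalRing.mem_maximalIdeal, PadicInt.mem_nonunits,
    PadicInt.norm_def]

lemma toZMod_eq_one_iff (x : ℤ_[p]) : PadicInt.toZMod x = 1 ↔ ‖(x : ℚ_[p]) - 1‖ < 1 := by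
  rw [← sub_eq_zero, ← map_one (PadicInt.toZMod (p := p)), ← map_sub, toZMod_eq_zero_iff]
  simp

variable {N}

lemma norm_det_iotaM (m : MM p N) : ‖(iotaM p N m : Matrix (Fin N) (Fin N) ℚ_[p]).det‖ = 1 := by
  have h : (iotaM p N m : Matrix (Fin N) (Fin N) ℚ_[p]).det
      = ((m : Matrix (Fin N) (Fin N) ℤ_[p]).det : ℚ_[p]) :=
    (RingHom.map_det PadicInt.Coe.ringHom (m : Matrix (Fin N) (Fin N) ℤ_[p])).symm
  rw [h, ← PadicInt.norm_def, ← PadicInt.isUnit_iff]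
  exact (Matrix.isUnit_iff_isUnit_det _).1 m.isUnit

lemma mem_Kset_iff (g : GG p N) : g ∈ Kset p N ↔
    (∀ i j, ‖g i j‖ ≤ 1) ∧ ‖(g : Matrix (Fin N) (Fin N) ℚ_[p]).det‖ = 1 := by
  constructor
  · rintro ⟨m, rfl⟩
    exact ⟨fun i j => (m i j).2, norm_det_iotaM m⟩
  · rintro ⟨h, hd⟩
    let A : Matrix (Fin N) (Fin N) ℤ_[p] := fun i j => ⟨g i j, h i j⟩
    have hA : (A.det : ℚ_[p]) = (g : Matrix (Fin N) (Fin N) ℚ_[p]).det :=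
      RingHom.map_det PadicInt.Coe.ringHom A
    have hu : IsUnit A.det := by
      rw [PadicInt.isUnit_iff, PadicInt.norm_def, hA, hd]
    refine ⟨Matrix.GeneralLinearGroup.mk'' A hu, ?_⟩
    ext i j
    rfl

lemma lt_one_of_mem_Iset {g : GG p N} (hg : g ∈ Iset p N) {i j : Fin N} (hij : j < i) :
    ‖g i j‖ < 1 := by
  obtain ⟨m, hm, rfl⟩ := hg
  exact (toZMod_eq_zero_iff _).1 (hm i j hij)

lemma I1set_subset_Iset : I1set p N ⊆ Iset p N :=
  Set.image_mono fun _ h => h.1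

lemma mem_I1set_iff (g : GG p N) : g ∈ I1set p N ↔
    g ∈ Kset p N ∧ (∀ i j, j < i → ‖g i j‖ < 1) ∧ ∀ i, ‖g i i - 1‖ < 1 := by
  constructor
  · rintro ⟨m, hm, rfl⟩
    exact ⟨⟨m, rfl⟩, fun i j hij => (toZMod_eq_zero_iff _).1 (hm.1 i j hij),
      fun i => (toZMod_eq_one_iff _).1 (hm.2 i)⟩
  · rintro ⟨⟨m, rfl⟩, h1, h2⟩
    exact ⟨m, ⟨fun i j hij => (toZMod_eq_zero_iff _).2 (h1 i j hij),
      fun i => (toZMod_eq_one_iff _).2 (h2 i)⟩, rfl⟩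

lemma I1pre_mul {a b : MM p 3} (ha : a ∈ I1pre p 3) (hb : b ∈ I1pre p 3) :
    a * b ∈ I1pre p 3 := by
  obtain ⟨ha, ha'⟩ := ha
  obtain ⟨hb, hb'⟩ := hb
  have e (i j) : (redM p 3 (a * b)) i j = ∑ k, redM p 3 a i k * redM p 3 b k j := by
    rw [map_mul]; rfl
  have a10 := ha 1 0 (by decide)
  have a20 := ha 2 0 (by decide)
  have a21 := ha 2 1 (by decide)
  have b10 := hb 1 0 (by decide)
  have b20 := hb 2 0 (by decide)
  have b21 := hb 2 1 (by decide)
  refine ⟨fun i j hij => ?_, fun i => ?_⟩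
  · rw [e, Fin.sum_univ_three]
    fin_cases i <;> fin_cases j <;> simp_all
  · rw [e, Fin.sum_univ_three]
    fin_cases i <;> simp_all

lemma I1pre_one : (1 : MM p 3) ∈ I1pre p 3 :=
  ⟨fun i j hij => by simp [hij.ne'], fun i => by simp⟩

lemma I1pre_inv {a : MM p 3} (ha : a ∈ I1pre p 3) : a⁻¹ ∈ I1pre p 3 := by
  have hpow : ∀ n : ℕ, a ^ n ∈ I1pre p 3 := by
    intro n
    induction n with
    | zero => rw [pow_zero]; exact I1pre_one
    | succ n ih => rw [pow_succ]; exact I1pre_mul ih ha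
  have h := hpow (orderOf (redM p 3 a) - 1)
  have e : redM p 3 a⁻¹ = redM p 3 (a ^ (orderOf (redM p 3 a) - 1)) := by
    rw [map_inv, map_pow, inv_eq_iff_mul_eq_one, ← pow_succ',
      Nat.sub_add_cancel (orderOf_pos _), pow_orderOf_eq_one]
  unfold I1pre Ipre at h ⊢
  simpa only [Set.mem_ofPred_eq, e] using h

variable (p) in
/-- The pro-p Iwahori subgroup of `GL_3`, bundled. -/
def I1 : Subgroup (GG p 3) where
  carrier := I1set p 3
  one_mem' := ⟨1, I1pre_one, map_one _⟩
  mul_mem' := by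
    rintro _ _ ⟨a, ha, rfl⟩ ⟨b, hb, rfl⟩
    exact ⟨a * b, I1pre_mul ha hb, map_mul _ _ _⟩
  inv_mem' := by
    rintro _ ⟨a, ha, rfl⟩
    exact ⟨a⁻¹, I1pre_inv ha, map_inv _ _⟩

lemma piSc_add (m n : ℤ) : piSc p N (m + n) = piSc p N m * piSc p N n := by
  simp only [piSc, scalarGL, _root_.zpow_add, map_mul]

lemma piSc_zero : piSc p N 0 = 1 := by
  simp [piSc, scalarGL]

lemma piSc_comm (n : ℤ) (g : GG p N) : g * piSc p N n = piSc p N n * g := by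
  exact Units.ext (Algebra.commutes ((pU p ^ n : ℚ_[p]ˣ) : ℚ_[p])
    (g : Matrix (Fin N) (Fin N) ℚ_[p])).symm

/-- `x` lies in `KZ g I_1`. -/
def InCell (g x : GG p 3) : Prop :=
  ∃ (n : ℤ) (m : MM p 3), ∃ u ∈ I1 p, x = piSc p 3 n * iotaM p 3 m * g * u

/-- Conditions on `g` and `h` under which the Hecke operator of `h` sends the standard function
at `g` to the standard function at `g * h`. -/
structure Good (g h : GG p 3) : Prop where
  cell : ∀ u ∈ I1 p, InCell (g * h) (g * u * h)
  conj : ∀ r ∈ I1 p, InCell g (g * h * r * h⁻¹) → h * r * h⁻¹ ∈ I1 p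

lemma InCell.trans {g x y : GG p 3} (h : InCell g x) (h' : InCell x y) : InCell g y := by
  obtain ⟨n, m, u, hu, rfl⟩ := h
  obtain ⟨n', m', u', hu', rfl⟩ := h'
  refine ⟨n' + n, m' * m, u * u', mul_mem hu hu', ?_⟩
  rw [piSc_add, map_mul]
  have := piSc_comm n (iotaM p 3 m')
  calc _ = piSc p 3 n' * (iotaM p 3 m' * piSc p 3 n) * iotaM p 3 m * g * u * u' := by group
    _ = _ := by rw [this]; group

lemma InCell.symm {g x : GG p 3} (h : InCell g x) : InCell x g := by
  obtain ⟨n, m, u, hu, rfl⟩ := h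
  refine ⟨-n, m⁻¹, u⁻¹, inv_mem hu, ?_⟩
  have := piSc_comm n (iotaM p 3 m)⁻¹
  calc g = (piSc p 3 (-n + n)) * g := by simp [piSc_zero]
    _ = piSc p 3 (-n) * ((iotaM p 3 m)⁻¹ * piSc p 3 n) * iotaM p 3 m * g := by
      rw [this, piSc_add]; group
    _ = _ := by rw [map_inv]; group

lemma InCell.left {g x : GG p 3} (h : InCell g x) (n : ℤ) (m : MM p 3) :
    InCell g (piSc p 3 n * iotaM p 3 m * x) :=
  h.trans ⟨n, m, 1, one_mem _, by group⟩

lemma InCell.right {g x u : GG p 3} (h : InCell g x) (hu : u ∈ I1 p) : InCell g (x * u) :=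
  h.trans ⟨0, 1, u, hu, by simp [piSc_zero]⟩

lemma InCell.refl (g : GG p 3) : InCell g g := ⟨0, 1, 1, one_mem _, by simp [piSc_zero]⟩

lemma InCell.mul_piSc (g : GG p 3) (n : ℤ) : InCell g (g * piSc p 3 n) :=
  ⟨n, 1, 1, one_mem _, by simp [piSc_comm]⟩

lemma Good.mul {g h k : GG p 3} (H : Good g h) (H' : Good (g * h) k) : Good g (h * k) where
  cell u hu := by
    obtain ⟨n, m, u', hu', e⟩ := H.cell u hu
    rw [show g * u * (h * k) = piSc p 3 n * iotaM p 3 m * (g * h * u' * k) by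
      rw [← mul_assoc, e]; group, ← mul_assoc]
    exact (H'.cell u' hu').left n m
  conj r hr hc := by
    have h1 : k * r * k⁻¹ ∈ I1 p := by
      refine H'.conj r hr ?_
      obtain ⟨n, m, u, hu, e⟩ := hc
      rw [show g * h * k * r * k⁻¹ = piSc p 3 n * iotaM p 3 m * (g * u * h) by
        have : g * h * k * r * k⁻¹ = g * (h * k) * r * (h * k)⁻¹ * h := by group
        rw [this, e]; group]
      exact (H.cell u hu).left n m
    have h2 := H.conj _ h1 (by
      convert hc using 1; group)
    convert h2 using 1; group

lemma Good.one (g : GG p 3) : Good g 1 where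
  cell u hu := by simpa using (InCell.refl g).right hu
  conj r hr _ := by simpa using hr

lemma Good.of_mul_piSc {g h : GG p 3} {n : ℤ} (H : Good g (h * piSc p 3 n)) : Good g h where
  cell u hu := by
    have h1 := H.cell u hu
    rw [← mul_assoc, ← mul_assoc] at h1
    exact ((InCell.mul_piSc _ n).trans h1).trans (InCell.mul_piSc _ n).symm
  conj r hr hc := by
    have e : h * piSc p 3 n * r * (h * piSc p 3 n)⁻¹ = h * r * h⁻¹ := by
      rw [mul_assoc h, ← piSc_comm]; group
    have := H.conj r hr (by
      convert hc using 1
      calc _ = g * (h * piSc p 3 n * r * (h * piSc p 3 n)⁻¹) := by group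
        _ = _ := by rw [e]; group)
    rwa [e] at this

/-- The standard function at an arbitrary `g`. -/
structure Std {V : Type} [AddCommGroup V] [Module (kb p) V]
    (ρ : Representation (kb p) (Gk p 3) V) (v₀ : V) (g : GG p 3) (f : GG p 3 → V) : Prop where
  left : ∀ (n : ℤ) (m : MM p 3) (x : GG p 3),
    f (piSc p 3 n * iotaM p 3 m * x) = ρ (redM p 3 m) (f x)
  right : ∀ u ∈ I1 p, ∀ x, f (x * u) = f x
  supp : ∀ x, f x ≠ 0 → InCell g x
  val : f g = v₀

section

variable {V : Type} [AddCommGroup V] [Module (kb p) V]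
  {ρ : Representation (kb p) (Gk p 3) V} {v₀ : V}

lemma Std.unique {g : GG p 3} {f f' : GG p 3 → V} (h : Std ρ v₀ g f) (h' : Std ρ v₀ g f') :
    f = f' := by
  funext x
  by_cases hx : InCell g x
  · obtain ⟨n, m, u, hu, rfl⟩ := hx
    rw [h.right u hu, h'.right u hu, h.left, h'.left, h.val, h'.val]
  · rw [not_not.1 (mt (h.supp x) hx), not_not.1 (mt (h'.supp x) hx)]

lemma Std.of_mul_piSc {g : GG p 3} {n : ℤ} {f : GG p 3 → V} (h : Std ρ v₀ (g * piSc p 3 n) f) :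
    Std ρ v₀ g f where
  left := h.left
  right := h.right
  supp x hx := (InCell.mul_piSc g n).trans (h.supp x hx)
  val := by
    have := h.left n 1 g
    rw [map_one, mul_one, ← piSc_comm, h.val] at this
    simpa using this.symm

lemma hk_right {f : GG p 3 → V} (hf : ∀ u ∈ I1 p, ∀ x, f (x * u) = f x) {h : GG p 3}
    {R : Finset (GG p 3)} (hR : IsRepSet p 3 h R) (u : GG p 3) (hu : u ∈ I1 p) (x : GG p 3) :
    hk p 3 h R f (x * u) = hk p 3 h R f x := by
  obtain ⟨hsub, hrep⟩ := hR
  have hrep' : ∀ y ∈ I1 p, ∃ r ∈ R, r⁻¹ * y ∈ I1 p ∧ h * (r⁻¹ * y) * h⁻¹ ∈ I1 p :=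
    fun y hy => (hrep y hy).exists
  choose! φ hφR hφ hφ' using hrep'
  have hI : ∀ r ∈ R, r ∈ I1 p := fun r hr => hsub hr
  have hinv : ∀ w ∈ I1 p, ∀ r ∈ R, φ (w⁻¹ * φ (w * r)) = r := by
    intro w hw r hr
    have hwr : w * r ∈ I1 p := mul_mem hw (hI r hr)
    have hy : w⁻¹ * φ (w * r) ∈ I1 p := mul_mem (inv_mem hw) (hI _ (hφR _ hwr))
    refine (hrep _ hy).unique ⟨hφR _ hy, hφ _ hy, hφ' _ hy⟩ ⟨hr, ?_, ?_⟩
    · show _ ∈ I1 p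
      convert inv_mem (hφ _ hwr) using 1; group
    · show _ ∈ I1 p
      convert inv_mem (hφ' _ hwr) using 1; group
  refine Finset.sum_nbij' (fun r => φ (u * r)) (fun r => φ (u⁻¹ * r))
    (fun r hr => hφR _ (mul_mem hu (hI r hr)))
    (fun r hr => hφR _ (mul_mem (inv_mem hu) (hI r hr)))
    (fun r hr => hinv u hu r hr)
    (fun r hr => by simpa using hinv u⁻¹ (inv_mem hu) r hr) (fun r hr => ?_)
  have hur : u * r ∈ I1 p := mul_mem hu (hI r hr)
  rw [← hf _ (hφ' _ hur) (x * φ (u * r) * h⁻¹)]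
  congr 1; group

lemma Std.hecke {g h : GG p 3} {f : GG p 3 → V} {R : Finset (GG p 3)} (hf : Std ρ v₀ g f)
    (H : Good g h) (hR : IsRepSet p 3 h R) : Std ρ v₀ (g * h) (hk p 3 h R f) where
  left n m x := by
    simp only [hk, map_sum, mul_assoc (piSc p 3 n * iotaM p 3 m), hf.left]
  right u hu x := hk_right hf.right hR u hu x
  supp x hx := by
    obtain ⟨r, hr, hne⟩ := Finset.exists_ne_zero_of_sum_ne_zero hx
    obtain ⟨n, m, u, hu, e⟩ := hf.supp _ hne
    have hx' : x = piSc p 3 n * iotaM p 3 m * (g * u * h) * r⁻¹ := by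
      calc x = (x * r * h⁻¹) * h * r⁻¹ := by group
        _ = _ := by rw [e]; group
    rw [hx']
    exact ((H.cell u hu).left n m).right (inv_mem (hR.1 hr))
  val := by
    obtain ⟨r₀, ⟨hr₀, h1, h2⟩, huniq⟩ := hR.2 1 (one_mem (I1 p))
    have hI : ∀ r ∈ R, r ∈ I1 p := fun r hr => hR.1 hr
    have key : ∀ r, g * h * r * h⁻¹ = g * (h * r * h⁻¹) := fun r => by group
    rw [hk, Finset.sum_eq_single_of_mem r₀ hr₀, key, hf.right, hf.val]
    · convert (I1 p).inv_mem h2 using 1; group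
    · intro r hr hne
      by_contra h0
      refine hne (huniq r ⟨hr, ?_, ?_⟩)
      · show r⁻¹ * 1 ∈ I1 p
        rw [mul_one]; exact inv_mem (hI r hr)
      · show h * (r⁻¹ * 1) * h⁻¹ ∈ I1 p
        convert inv_mem (H.conj r (hI r hr) (hf.supp _ h0)) using 1; group

end

lemma norm_p_zpow (n : ℤ) : ‖((p : ℚ_[p]) ^ n)‖ = (p : ℝ) ^ (-n) := by
  rw [norm_zpow, Padic.norm_p, _root_.inv_zpow, _root_.zpow_neg]

lemma mem_I1_iff (g : GG p 3) : g ∈ I1 p ↔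
    ‖(g : Matrix (Fin 3) (Fin 3) ℚ_[p]).det‖ = 1 ∧
    (‖g 0 1‖ ≤ 1 ∧ ‖g 0 2‖ ≤ 1 ∧ ‖g 1 2‖ ≤ 1) ∧
    (‖g 1 0‖ < 1 ∧ ‖g 2 0‖ < 1 ∧ ‖g 2 1‖ < 1) ∧
    ‖g 0 0 - 1‖ < 1 ∧ ‖g 1 1 - 1‖ < 1 ∧ ‖g 2 2 - 1‖ < 1 := by
  change g ∈ I1set p 3 ↔ _
  rw [mem_I1set_iff, mem_Kset_iff]
  constructor
  · rintro ⟨⟨h, hd⟩, h1, h2⟩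
    exact ⟨hd, ⟨h _ _, h _ _, h _ _⟩, ⟨h1 _ _ (by decide), h1 _ _ (by decide),
      h1 _ _ (by decide)⟩, h2 _, h2 _, h2 _⟩
  · rintro ⟨hd, ⟨h01, h02, h12⟩, ⟨h10, h20, h21⟩, h00, h11, h22⟩
    have hdiag : ∀ x : ℚ_[p], ‖x - 1‖ < 1 → ‖x‖ ≤ 1 := fun x hx => by
      have := Padic.nonarchimedean (x - 1) 1
      rw [sub_add_cancel, norm_one] at this
      exact this.trans (max_le hx.le le_rfl)
    refine ⟨⟨fun i j => ?_, hd⟩, fun i j hij => ?_, fun i => ?_⟩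
    · fin_cases i <;> fin_cases j <;> first | assumption | exact hdiag _ ‹_› | exact le_of_lt ‹_›
    · fin_cases i <;> fin_cases j <;> first | assumption | exact absurd hij (by decide)
    · fin_cases i <;> assumption

variable (p) in
/-- The monomial matrix sending `e_j` to `p ^ (m j) • e_{σ j}`. -/
def mono (σ : Equiv.Perm (Fin 3)) (m : Fin 3 → ℤ) : GG p 3 :=
  permGL p 3 σ * diagGL p 3 fun i => pU p ^ m i

lemma mono_apply (σ : Equiv.Perm (Fin 3)) (m : Fin 3 → ℤ) (i j : Fin 3) :
    mono p σ m i j = if i = σ j then (p : ℚ_[p]) ^ m j else 0 := by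
  have : mono p σ m i j
      = ((σ⁻¹).permMatrix ℚ_[p] * Matrix.diagonal fun i => ((pU p ^ m i : ℚ_[p]ˣ) : ℚ_[p])) i j :=
    rfl
  rw [this, Matrix.mul_diagonal]
  simp [Equiv.toPEquiv_apply, PEquiv.toMatrix_apply, pU, Equiv.symm_apply_eq]

lemma mono_mul (σ τ : Equiv.Perm (Fin 3)) (m n : Fin 3 → ℤ) :
    mono p σ m * mono p τ n = mono p (σ * τ) fun i => m (τ i) + n i := by
  have hp : (p : ℚ_[p]) ≠ 0 := Nat.cast_ne_zero.2 (Fact.out : p.Prime).ne_zero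
  ext i j
  rw [Units.val_mul, Matrix.mul_apply]
  simp only [mono_apply, mul_ite, ite_mul, zero_mul, mul_zero, Finset.sum_ite_eq',
    Finset.mem_univ, if_true, Equiv.Perm.mul_apply, zpow_add₀ hp]

lemma mono_one (n : ℤ) : mono p 1 (fun _ => n) = piSc p 3 n := by
  ext i j
  have : piSc p 3 n i j = algebraMap ℚ_[p] (Matrix (Fin 3) (Fin 3) ℚ_[p])
      ((pU p ^ n : ℚ_[p]ˣ) : ℚ_[p]) i j := rfl
  rw [mono_apply, this, Matrix.algebraMap_matrix_apply]
  simp only [pU, Equiv.Perm.coe_one, id_eq, Units.val_zpow_eq_zpow_val, Units.val_mk0]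
  by_cases h : i = j <;> simp [h]

lemma mono_conj_apply (σ : Equiv.Perm (Fin 3)) (m : Fin 3 → ℤ) (x : GG p 3) (i j : Fin 3) :
    (mono p σ m * x * (mono p σ m)⁻¹) (σ i) (σ j) = (p : ℚ_[p]) ^ (m i - m j) * x i j := by
  have hp : (p : ℚ_[p]) ≠ 0 := Nat.cast_ne_zero.2 (Fact.out : p.Prime).ne_zero
  have h : mono p σ m * x * (mono p σ m)⁻¹ * mono p σ m = mono p σ m * x := by group
  generalize mono p σ m * x * (mono p σ m)⁻¹ = y at h ⊢
  have h' : (y * mono p σ m) (σ i) j = (mono p σ m * x) (σ i) j := by rw [h]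
  rw [Units.val_mul, Units.val_mul, Matrix.mul_apply, Matrix.mul_apply] at h'
  simp only [mono_apply, mul_ite, ite_mul, zero_mul, mul_zero, Finset.sum_ite_eq',
    Finset.mem_univ, if_true, σ.injective.eq_iff, Finset.sum_ite_eq] at h'
  rw [zpow_sub₀ hp, div_mul_eq_mul_div, eq_div_iff (zpow_ne_zero _ hp), h']

lemma norm_mono_conj (σ : Equiv.Perm (Fin 3)) (m : Fin 3 → ℤ) (x : GG p 3) (i j : Fin 3) :
    ‖(mono p σ m * x * (mono p σ m)⁻¹) (σ i) (σ j)‖ = (p : ℝ) ^ (m j - m i) * ‖x i j‖ := by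
  rw [mono_conj_apply, norm_mul, norm_p_zpow, neg_sub]

lemma det_conj (g x : GG p 3) : ((g * x * g⁻¹ : GG p 3) : Matrix (Fin 3) (Fin 3) ℚ_[p]).det
    = (x : Matrix (Fin 3) (Fin 3) ℚ_[p]).det := by
  rw [Units.val_mul, Units.val_mul, Matrix.det_units_conj]

@[simp] lemma w2_zero : w2 3 0 = 2 := by decide
@[simp] lemma w2_one : w2 3 1 = 0 := by decide
@[simp] lemma w2_two : w2 3 2 = 1 := by decide

@[simp] lemma swap_zero_one_two : Equiv.swap (0 : Fin 3) 1 2 = 2 := by decide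

@[simp] lemma expo_zero (a : Fin 2 → ℤ) : expo 3 a 0 = a 0 := rfl
@[simp] lemma expo_one (a : Fin 2 → ℤ) : expo 3 a 1 = a 1 := rfl
@[simp] lemma expo_two (a : Fin 2 → ℤ) : expo 3 a 2 = 0 := rfl

lemma gammaGL_eq : gammaGL p 3 = mono p (w2 3) ![1, 0, 0] := by
  unfold gammaGL mono tGL
  congr 3
  funext i
  fin_cases i <;> simp [expo]

lemma gamma_conj_mem {u : GG p 3} (hu : u ∈ I1 p) :
    gammaGL p 3 * u * (gammaGL p 3)⁻¹ ∈ I1 p := by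
  rw [gammaGL_eq]
  rw [mem_I1_iff] at hu
  obtain ⟨hd, ⟨h01, h02, h12⟩, ⟨h10, h20, h21⟩, h00, h11, h22⟩ := hu
  have e := mono_conj_apply (w2 3) ![1, 0, 0] u
  have e' := norm_mono_conj (w2 3) ![1, 0, 0] u
  have hp : 1 < (p : ℝ) := by exact_mod_cast (Fact.out : p.Prime).one_lt
  have hp0 : 0 < (p : ℝ) := by linarith
  have hlt : ∀ x : ℚ_[p], ‖x‖ < 1 → p * ‖x‖ ≤ 1 := fun x hx => by
    have := (Padic.norm_le_pow_iff_norm_lt_pow_add_one x (-1)).2 (by simpa using hx)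
    rw [_root_.zpow_neg_one] at this
    calc p * ‖x‖ ≤ p * (p : ℝ)⁻¹ := by gcongr
      _ = 1 := mul_inv_cancel₀ hp0.ne'
  have hle : ∀ x : ℚ_[p], ‖x‖ ≤ 1 → (p : ℝ)⁻¹ * ‖x‖ < 1 := fun x hx => by
    rw [inv_mul_lt_iff₀ hp0]; linarith
  have y00 := e 1 1
  have y11 := e 2 2
  have y22 := e 0 0
  have y01 := e' 1 2
  have y02 := e' 1 0
  have y12 := e' 2 0
  have y10 := e' 2 1
  have y20 := e' 0 1
  have y21 := e' 0 2
  simp only [w2_zero, w2_one, w2_two, Matrix.cons_val] at y00 y11 y22 y01 y02 y12 y10 y20 y21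
  rw [mem_I1_iff, det_conj]
  generalize mono p (w2 3) ![1, 0, 0] * u * (mono p (w2 3) ![1, 0, 0])⁻¹ = y at *
  norm_num at y00 y11 y22 y01 y02 y12 y10 y20 y21
  rw [y00, y11, y22, y01, y02, y12, y10, y20, y21]
  exact ⟨hd, ⟨h12, hlt _ h10, hlt _ h20⟩, ⟨h21, hle _ h01, hle _ h02⟩, h11, h22, h00⟩

lemma gamma_cube : gammaGL p 3 * gammaGL p 3 * gammaGL p 3 = piSc p 3 1 := by
  rw [← mono_one, gammaGL_eq, mono_mul, mono_mul]
  congr 1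
  · decide
  · funext i
    fin_cases i <;> simp

lemma gamma_inv_conj_mem {u : GG p 3} (hu : u ∈ I1 p) :
    (gammaGL p 3)⁻¹ * u * gammaGL p 3 ∈ I1 p := by
  have h : u * (gammaGL p 3 * gammaGL p 3 * gammaGL p 3)
      = gammaGL p 3 * gammaGL p 3 * gammaGL p 3 * u := by
    rw [gamma_cube, piSc_comm]
  convert gamma_conj_mem (gamma_conj_mem hu) using 1
  generalize gammaGL p 3 = γ at h ⊢
  calc γ⁻¹ * u * γ = γ⁻¹ * (u * (γ * γ * γ)) * γ⁻¹ * γ⁻¹ := by group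
    _ = _ := by rw [h]; group

lemma good_gamma (g : GG p 3) : Good g (gammaGL p 3) where
  cell u hu := by
    convert (InCell.refl (g * gammaGL p 3)).right (gamma_inv_conj_mem hu) using 1
    group
  conj r hr _ := gamma_conj_mem hr

variable (p) in
/-- The elementary matrix with entry `c` at `(i, j)`. -/
def elem {i j : Fin 3} (hij : i ≠ j) (c : ℚ_[p]) : GG p 3 where
  val := Matrix.transvection i j c
  inv := Matrix.transvection i j (-c)
  val_inv := by rw [Matrix.transvection_mul_transvection_same _ _ hij]; simp
  inv_val := by rw [Matrix.transvection_mul_transvection_same _ _ hij]; simp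

lemma elem_apply {i j : Fin 3} (hij : i ≠ j) (c : ℚ_[p]) (k l : Fin 3) :
    elem p hij c k l = if k = l then 1 else if i = k ∧ j = l then c else 0 := by
  have : elem p hij c k l = (1 + Matrix.single i j c : Matrix _ _ _) k l := rfl
  rw [this, Matrix.add_apply, Matrix.one_apply, Matrix.single_apply]
  by_cases h : k = l
  · subst h
    have : ¬ (i = k ∧ j = k) := fun h => hij (h.1.trans h.2.symm)
    simp [this]
  · simp [h]

lemma det_elem {i j : Fin 3} (hij : i ≠ j) (c : ℚ_[p]) :
    (elem p hij c : Matrix (Fin 3) (Fin 3) ℚ_[p]).det = 1 :=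
  Matrix.det_transvection_of_ne i j hij c

lemma elem_mem_I1 {i j : Fin 3} (hij : i ≠ j) {c : ℚ_[p]} (hc : ‖c‖ ≤ 1)
    (hc' : j < i → ‖c‖ < 1) : elem p hij c ∈ I1 p := by
  refine (mem_I1set_iff _).2 ⟨(mem_Kset_iff _).2 ⟨fun k l => ?_, by simp [det_elem]⟩,
    fun k l hkl => ?_, fun k => by simp [elem_apply]⟩
  · rw [elem_apply]
    split_ifs <;> simp [hc]
  · rw [elem_apply, if_neg hkl.ne']
    split_ifs with h
    · exact hc' (h.1 ▸ h.2 ▸ hkl)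
    · simp

lemma conj_elem_mem_Kset (σ : Equiv.Perm (Fin 3)) (m : Fin 3 → ℤ) {i j : Fin 3} (hij : i ≠ j)
    {c : ℚ_[p]} (hc : (p : ℝ) ^ (m j - m i) * ‖c‖ ≤ 1) :
    mono p σ m * elem p hij c * (mono p σ m)⁻¹ ∈ Kset p 3 := by
  refine (mem_Kset_iff _).2 ⟨fun k l => ?_, by rw [det_conj, det_elem, norm_one]⟩
  obtain ⟨k, rfl⟩ := σ.surjective k
  obtain ⟨l, rfl⟩ := σ.surjective l
  rw [norm_mono_conj, elem_apply]
  split_ifs with h1 h2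
  · simp [h1]
  · rwa [← h2.1, ← h2.2]
  · simp

lemma Sset_lt {σ : Equiv.Perm (Fin 3)} {a : Fin 2 → ℤ} (ha : a ∈ Sset p 3 σ) {i j : Fin 3}
    (hσ : σ j < σ i) : expo 3 a j < expo 3 a i + if j < i then 1 else 0 := by
  have hp : 1 < (p : ℝ) := by exact_mod_cast (Fact.out : p.Prime).one_lt
  have hij : i ≠ j := fun h => by simp [h] at hσ
  by_contra! hcon
  set k := expo 3 a j - expo 3 a i with hk
  have hk0 : 0 ≤ k := by split_ifs at hcon <;> omega
  have hmem : elem p hij ((p : ℚ_[p]) ^ k) ∈ I1 p := by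
    refine elem_mem_I1 hij ?_ fun h => ?_ <;> rw [norm_p_zpow]
    · exact zpow_le_one_of_nonpos₀ hp.le (by omega)
    · rw [if_pos h] at hcon
      exact zpow_lt_one_of_neg₀ hp (by omega)
  have h := ha _ (I1set_subset_Iset hmem) (conj_elem_mem_Kset σ (expo 3 a) hij (by
    rw [norm_p_zpow, ← zpow_add₀ (by linarith), ← hk]; simp))
  have h' := lt_one_of_mem_Iset h hσ
  change ‖(mono p σ (expo 3 a) * _ * (mono p σ (expo 3 a))⁻¹) _ _‖ < 1 at h'
  rw [norm_mono_conj, elem_apply, if_neg hij, if_pos ⟨rfl, rfl⟩, norm_p_zpow,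
    ← zpow_add₀ (by linarith), ← hk] at h'
  simp at h'

lemma swap_eq : permGL p 3 (Equiv.swap 0 1) = mono p (Equiv.swap 0 1) 0 := by
  have : diagGL p 3 (fun i => pU p ^ (0 : Fin 3 → ℤ) i) = 1 := by
    apply Units.ext
    simp [diagGL]
  rw [mono, this, mul_one]

lemma swap_conj_mem {u : GG p 3} (hu : u ∈ I1 p) (h : ‖u 0 1‖ < 1) :
    permGL p 3 (Equiv.swap 0 1) * u * (permGL p 3 (Equiv.swap 0 1))⁻¹ ∈ I1 p := by
  rw [mem_I1_iff] at hu
  obtain ⟨hd, ⟨h01, h02, h12⟩, ⟨h10, h20, h21⟩, h00, h11, h22⟩ := hu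
  have e := mono_conj_apply (Equiv.swap 0 1) 0 u
  have y00 := e 1 1
  have y11 := e 0 0
  have y22 := e 2 2
  have y01 := e 1 0
  have y02 := e 1 2
  have y12 := e 0 2
  have y10 := e 0 1
  have y20 := e 2 1
  have y21 := e 2 0
  simp only [Equiv.swap_apply_left, Equiv.swap_apply_right, swap_zero_one_two, Pi.zero_apply,
    sub_zero, zpow_zero, one_mul] at y00 y11 y22 y01 y02 y12 y10 y20 y21
  rw [swap_eq, mem_I1_iff, det_conj, y00, y11, y22, y01, y02, y12, y10, y20, y21]
  exact ⟨hd, ⟨h10.le, h12, h02⟩, ⟨h, h21, h20⟩, h11, h00, h22⟩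

lemma swap_inv : (permGL p 3 (Equiv.swap 0 1))⁻¹ = permGL p 3 (Equiv.swap 0 1) := by
  apply Units.ext
  change (Equiv.swap (0 : Fin 3) 1).permMatrix ℚ_[p]
    = ((Equiv.swap (0 : Fin 3) 1)⁻¹).permMatrix ℚ_[p]
  rw [Equiv.swap_inv]

lemma norm_det_piSc (n : ℤ) :
    ‖(piSc p 3 n : Matrix (Fin 3) (Fin 3) ℚ_[p]).det‖ = ((p : ℝ) ^ (-n)) ^ 3 := by
  have : (piSc p 3 n : Matrix (Fin 3) (Fin 3) ℚ_[p])
      = algebraMap ℚ_[p] _ ((pU p ^ n : ℚ_[p]ˣ) : ℚ_[p]) := rfl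
  rw [this, Matrix.algebraMap_eq_diagonal, Matrix.det_diagonal]
  simp [pU]

lemma conj_mem_Kset_of_inCell {g x : GG p 3} (h : InCell g (g * x))
    (hx : ‖(x : Matrix (Fin 3) (Fin 3) ℚ_[p]).det‖ = 1) :
    ∃ u ∈ I1 p, g * (x * u) * g⁻¹ ∈ Kset p 3 := by
  have hp : 1 < (p : ℝ) := by exact_mod_cast (Fact.out : p.Prime).one_lt
  obtain ⟨n, m, u, hu, e⟩ := h
  have e' : g * (x * u⁻¹) * g⁻¹ = piSc p 3 n * iotaM p 3 m := by
    rw [← mul_assoc, e]; group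
  refine ⟨u⁻¹, inv_mem hu, ?_⟩
  have hd : ‖((g * (x * u⁻¹) * g⁻¹ : GG p 3) : Matrix (Fin 3) (Fin 3) ℚ_[p]).det‖ = 1 := by
    rw [det_conj, Units.val_mul, Matrix.det_mul, norm_mul, hx,
      ((mem_I1_iff _).1 (inv_mem hu)).1, one_mul]
  rw [e', Units.val_mul, Matrix.det_mul, norm_mul, norm_det_iotaM, mul_one, norm_det_piSc,
    pow_eq_one_iff_of_nonneg (zpow_nonneg (by linarith) _) (by norm_num),
    zpow_eq_one_iff_right₀ (by linarith) hp.ne', neg_eq_zero] at hd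
  rw [e', hd, piSc_zero, one_mul]
  exact ⟨m, rfl⟩

lemma good_swap (σ : Equiv.Perm (Fin 3)) (m : Fin 3 → ℤ) (hm : m 1 < m 0) :
    Good (mono p σ m) (permGL p 3 (Equiv.swap 0 1)) where
  cell u hu := by
    have hp : 1 < (p : ℝ) := by exact_mod_cast (Fact.out : p.Prime).one_lt
    have h01 : (0 : Fin 3) ≠ 1 := by decide
    obtain ⟨-, ⟨h1, -, -⟩, -, -, h2, -⟩ := (mem_I1_iff u).1 hu
    have hu' : (elem p h01 (u 0 1))⁻¹ * u ∈ I1 p :=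
      mul_mem (inv_mem (elem_mem_I1 h01 h1 (by simp))) hu
    have hlt : ‖((elem p h01 (u 0 1))⁻¹ * u) 0 1‖ < 1 := by
      have : (elem p h01 (u 0 1))⁻¹ = elem p h01 (-(u 0 1)) := Units.ext rfl
      rw [this, Units.val_mul, Matrix.mul_apply, Fin.sum_univ_three]
      simp only [elem_apply]
      simp only [Fin.isValue, reduceIte, one_mul, zero_ne_one, and_self, Fin.reduceEq, and_false,
        zero_mul, add_zero]
      rw [show u 0 1 + -u 0 1 * u 1 1 = -(u 0 1 * (u 1 1 - 1)) by ring, norm_neg, norm_mul]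
      exact mul_lt_one_of_nonneg_of_lt_one_right h1 (norm_nonneg _) h2
    obtain ⟨k, hk⟩ := conj_elem_mem_Kset σ m h01 (c := u 0 1)
      (mul_le_one₀ (zpow_le_one_of_nonpos₀ hp.le (by omega)) (norm_nonneg _) h1)
    refine ⟨0, k, _, swap_conj_mem hu' hlt, ?_⟩
    rw [hk, piSc_zero]
    have hw := swap_inv (p := p)
    generalize permGL p 3 (Equiv.swap 0 1) = w at hw ⊢
    have hww : w * w = 1 := mul_eq_one_iff_eq_inv.2 hw.symm
    generalize elem p h01 (u 0 1) = e
    calc mono p σ m * u * w = mono p σ m * e * 1 * (e⁻¹ * u) * w⁻¹ := by rw [hw]; group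
      _ = mono p σ m * e * (w * w) * (e⁻¹ * u) * w⁻¹ := by rw [hww]
      _ = _ := by group
  conj r hr hc := by
    have hp : 1 < (p : ℝ) := by exact_mod_cast (Fact.out : p.Prime).one_lt
    set w := permGL p 3 (Equiv.swap 0 1) with hw
    have hdet : ‖((w * r * w⁻¹ : GG p 3) : Matrix (Fin 3) (Fin 3) ℚ_[p]).det‖ = 1 := by
      rw [det_conj, ((mem_I1_iff _).1 hr).1]
    obtain ⟨u, hu, hK⟩ := conj_mem_Kset_of_inCell (g := mono p σ m) (x := w * r * w⁻¹)
      (by convert hc using 1; group) hdet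
    have h10 := ((mem_Kset_iff _).1 hK).1 (σ 1) (σ 0)
    rw [norm_mono_conj] at h10
    have hy : ‖((w * r * w⁻¹) * u) 1 0‖ < 1 := by
      by_contra! hge
      have : 1 < (p : ℝ) ^ (m 0 - m 1) := one_lt_zpow₀ hp (by omega)
      nlinarith
    refine swap_conj_mem hr ?_
    have e10 := mono_conj_apply (Equiv.swap 0 1) 0 r 0 1
    have e11 := mono_conj_apply (Equiv.swap 0 1) 0 r 0 0
    have e12 := mono_conj_apply (Equiv.swap 0 1) 0 r 0 2
    simp only [Equiv.swap_apply_left, Equiv.swap_apply_right, swap_zero_one_two, Pi.zero_apply,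
      sub_zero, zpow_zero, one_mul, ← swap_eq, ← hw] at e10 e11 e12
    rw [Units.val_mul, Matrix.mul_apply, Fin.sum_univ_three, e10, e11, e12] at hy
    have hIr := (mem_I1set_iff r).1 hr
    have hIu := (mem_I1set_iff u).1 hu
    have hKr := ((mem_Kset_iff r).1 hIr.1).1
    have b1 : ‖r 0 1 * (u 0 0 - 1)‖ < 1 := by
      rw [norm_mul]
      exact mul_lt_one_of_nonneg_of_lt_one_right (hKr _ _) (norm_nonneg _) (hIu.2.2 0)
    have b2 : ‖r 0 0 * u 1 0‖ < 1 := by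
      rw [norm_mul]
      exact mul_lt_one_of_nonneg_of_lt_one_right (hKr _ _) (norm_nonneg _)
        (hIu.2.1 1 0 (by decide))
    have b3 : ‖r 0 2 * u 2 0‖ < 1 := by
      rw [norm_mul]
      exact mul_lt_one_of_nonneg_of_lt_one_right (hKr _ _) (norm_nonneg _)
        (hIu.2.1 2 0 (by decide))
    have hsub : ∀ x y : ℚ_[p], ‖x‖ < 1 → ‖y‖ < 1 → ‖x - y‖ < 1 := fun x y hx hy =>
      (by simpa [sub_eq_add_neg] using Padic.nonarchimedean x (-y) :
        ‖x - y‖ ≤ max ‖x‖ ‖y‖).trans_lt (max_lt hx hy)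
    convert hsub _ _ (hsub _ _ (hsub _ _ hy b1) b2) b3 using 2
    ring

lemma permGL_mem_Kset (σ : Equiv.Perm (Fin 3)) : permGL p 3 σ ∈ Kset p 3 := by
  refine (mem_Kset_iff _).2 ⟨fun i j => ?_, ?_⟩
  · change ‖((σ⁻¹).permMatrix ℚ_[p]) i j‖ ≤ 1
    simp only [Equiv.Perm.permMatrix, PEquiv.toMatrix_apply]
    split_ifs <;> simp
  · change ‖((σ⁻¹).permMatrix ℚ_[p]).det‖ = 1
    rw [Matrix.det_permutation]
    rcases Int.units_eq_one_or (Equiv.Perm.sign σ⁻¹) with h | h <;> rw [h] <;> simp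

lemma permGL_one : permGL p 3 1 = 1 := by
  apply Units.ext
  change ((1 : Equiv.Perm (Fin 3))⁻¹).permMatrix ℚ_[p] = 1
  rw [inv_one, Matrix.permMatrix_one]

lemma tGL_eq (b : Fin 2 → ℤ) : tGL p 3 b = mono p 1 (expo 3 b) := by
  rw [mono, permGL_one, one_mul]
  rfl

section

variable {V : Type} [AddCommGroup V] [Module (kb p) V]
  {ρ : Representation (kb p) (Gk p 3) V} {v₀ : V}

lemma IsStd.std {σ : Equiv.Perm (Fin 3)} {a : Fin 2 → ℤ} {f : GG p 3 → V}
    (h : IsStd p 3 ρ v₀ σ a f) : Std ρ v₀ (mono p σ (expo 3 a)) f := by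
  obtain ⟨hind, hinv, hsupp, hval⟩ := h
  refine ⟨hind.1, hinv, fun x hx => ?_, hval⟩
  obtain ⟨n, m, u, hu, rfl⟩ := hsupp x hx
  obtain ⟨k, hk⟩ := permGL_mem_Kset (p := p) σ
  have : InCell (mono p σ (expo 3 a)) (tGL p 3 a) := by
    refine ⟨0, k⁻¹, 1, one_mem _, ?_⟩
    rw [mono, map_inv, hk, piSc_zero]
    simp only [one_mul, mul_one, inv_mul_cancel_left]
    rfl
  exact (this.left n m).right hu

/-- `F` is the standard function at `mono σ m * mono τ n`, and the second factor is good for the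
first. -/
structure Reach (ρ : Representation (kb p) (Gk p 3) V) (v₀ : V) (σ : Equiv.Perm (Fin 3))
    (m : Fin 3 → ℤ) (τ : Equiv.Perm (Fin 3)) (n : Fin 3 → ℤ) (F : GG p 3 → V) : Prop where
  std : Std ρ v₀ (mono p σ m * mono p τ n) F
  good : Good (mono p σ m) (mono p τ n)

variable {σ τ : Equiv.Perm (Fin 3)} {m : Fin 3 → ℤ} {n₀ n₁ n₂ : ℤ} {F : GG p 3 → V}

lemma Std.reach (h : Std ρ v₀ (mono p σ m) F) : Reach ρ v₀ σ m 1 ![0, 0, 0] F := by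
  have h1 : mono p 1 ![0, 0, 0] = 1 := by
    rw [← piSc_zero, ← mono_one]
    congr 1
    funext i
    fin_cases i <;> rfl
  exact ⟨by rwa [h1, mul_one], by rw [h1]; exact Good.one _⟩

lemma Reach.gamma (H : Reach ρ v₀ σ m τ ![n₀, n₁, n₂] F) {R : Finset (GG p 3)}
    (hR : IsRepSet p 3 (gammaGL p 3) R) :
    Reach ρ v₀ σ m (τ * w2 3) ![n₂ + 1, n₀, n₁] (hk p 3 (gammaGL p 3) R F) := by
  have e : mono p (τ * w2 3) ![n₂ + 1, n₀, n₁] = mono p τ ![n₀, n₁, n₂] * gammaGL p 3 := by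
    rw [gammaGL_eq, mono_mul]
    congr 1
    funext i
    fin_cases i <;> simp
  have hg := good_gamma (mono p σ m * mono p τ ![n₀, n₁, n₂])
  constructor
  · rw [e, ← mul_assoc]
    exact H.std.hecke hg hR
  · rw [e]
    exact H.good.mul hg

lemma Reach.swap (H : Reach ρ v₀ σ m τ ![n₀, n₁, n₂] F) {R : Finset (GG p 3)}
    (hR : IsRepSet p 3 (permGL p 3 (Equiv.swap 0 1)) R) (hlt : m (τ 1) + n₁ < m (τ 0) + n₀) :
    Reach ρ v₀ σ m (τ * Equiv.swap 0 1) ![n₁, n₀, n₂]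
      (hk p 3 (permGL p 3 (Equiv.swap 0 1)) R F) := by
  have e : mono p (τ * Equiv.swap 0 1) ![n₁, n₀, n₂]
      = mono p τ ![n₀, n₁, n₂] * permGL p 3 (Equiv.swap 0 1) := by
    rw [swap_eq, mono_mul]
    congr 1
    funext i
    fin_cases i <;> simp
  have hg : Good (mono p σ m * mono p τ ![n₀, n₁, n₂]) (permGL p 3 (Equiv.swap 0 1)) := by
    rw [mono_mul]
    exact good_swap _ _ hlt
  constructor
  · rw [e, ← mul_assoc]
    exact H.std.hecke hg hR
  · rw [e]
    exact H.good.mul hg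

lemma Reach.eq {a b c : Fin 2 → ℤ} {f f₁ : GG p 3 → V}
    (H : Reach ρ v₀ σ (expo 3 a) τ ![n₀, n₁, n₂] F) (hf : IsStd p 3 ρ v₀ σ a f)
    (hf₁ : IsStd p 3 ρ v₀ σ c f₁) {R : Finset (GG p 3)} (hR : IsRepSet p 3 (tGL p 3 b) R)
    (hτ : τ = 1) (h₀ : n₀ = b 0 + n₂) (h₁ : n₁ = b 1 + n₂) (hc₀ : c 0 - a 0 = b 0)
    (hc₁ : c 1 - a 1 = b 1) : F = f₁ ∧ hk p 3 (tGL p 3 b) R f = f₁ := by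
  have e : mono p τ ![n₀, n₁, n₂] = tGL p 3 b * piSc p 3 n₂ := by
    rw [tGL_eq, ← mono_one, mono_mul, hτ]
    congr 1
    funext i
    fin_cases i <;> simp [h₀, h₁]
  have e' : mono p σ (expo 3 a) * tGL p 3 b = mono p σ (expo 3 c) := by
    rw [tGL_eq, mono_mul]
    congr 1
    funext i
    fin_cases i <;> simp [← hc₀, ← hc₁]
  obtain ⟨hs, hg⟩ := H
  rw [e] at hs hg
  rw [← mul_assoc, e'] at hs
  have ht := hf.std.hecke hg.of_mul_piSc hR
  rw [e'] at ht
  exact ⟨hs.of_mul_piSc.unique hf₁.std, ht.unique hf₁.std⟩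

end

end Helpers

/-- explicit action of composite Hecke operators in the Iwahori–Hecke
case for `N = 3`. -/
theorem stmt14 (p : ℕ) [Fact p.Prime]
    {V : Type} [AddCommGroup V] [Module (kb p) V] [FiniteDimensional (kb p) V]
    (ρ : Representation (kb p) (Gk p 3) V) (hirr : IsIrred p 3 ρ)
    (v₀ : V) (hv₀ : v₀ ≠ 0)
    (hfix : ∀ m ∈ I1pre p 3, ρ (redM p 3 m) v₀ = v₀)
    (ξ : (Fin 3 → (ZMod p)ˣ) →* (kb p)ˣ)
    (hχ : ∀ m ∈ Ipre p 3, ρ (redM p 3 m) v₀ = (ξ (diagOf p 3 m) : kb p) • v₀)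
    (hdeg : ∀ (ν : Equiv.Perm (Fin 3)) (d : Fin 3 → (ZMod p)ˣ), ξ (d ∘ ⇑ν⁻¹) = ξ d) :
    (∀ a : Fin 2 → ℤ, a ∈ Sset p 3 (1 : Equiv.Perm (Fin 3)) →
      ∀ f f₁ f₂ : GG p 3 → V,
        IsStd p 3 ρ v₀ (1 : Equiv.Perm (Fin 3)) a f →
        IsStd p 3 ρ v₀ (1 : Equiv.Perm (Fin 3)) ![a 0 - 1, a 1] f₁ →
        IsStd p 3 ρ v₀ (1 : Equiv.Perm (Fin 3)) ![a 0 - 1, a 1 - 1] f₂ →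
        ∀ Rγ Rω R₁ R₂ : Finset (GG p 3),
          IsRepSet p 3 (gammaGL p 3) Rγ → IsRepSet p 3 (permGL p 3 (Equiv.swap (0 : Fin 3) 1)) Rω →
          IsRepSet p 3 (tGL p 3 ![-1, 0]) R₁ → IsRepSet p 3 (tGL p 3 ![-1, -1]) R₂ →
          (hk p 3 (permGL p 3 (Equiv.swap (0 : Fin 3) 1)) Rω (hk p 3 (gammaGL p 3) Rγ (hk p 3 (permGL p 3 (Equiv.swap (0 : Fin 3) 1)) Rω (hk p 3 (gammaGL p 3) Rγ (f)))) = f₁ ∧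
           hk p 3 (tGL p 3 ![-1, 0]) R₁ f = f₁ ∧
           hk p 3 (gammaGL p 3) Rγ (hk p 3 (permGL p 3 (Equiv.swap (0 : Fin 3) 1)) Rω (hk p 3 (gammaGL p 3) Rγ (hk p 3 (gammaGL p 3) Rγ (hk p 3 (permGL p 3 (Equiv.swap (0 : Fin 3) 1)) Rω (hk p 3 (gammaGL p 3) Rγ (f)))))) = f₂ ∧
           hk p 3 (tGL p 3 ![-1, -1]) R₂ f = f₂)) ∧
    (∀ a : Fin 2 → ℤ, a ∈ Sset p 3 (Equiv.swap (0 : Fin 3) 1) →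
      ∀ f f₁ f₂ : GG p 3 → V,
        IsStd p 3 ρ v₀ (Equiv.swap (0 : Fin 3) 1) a f →
        IsStd p 3 ρ v₀ (Equiv.swap (0 : Fin 3) 1) ![a 0, a 1 - 1] f₁ →
        IsStd p 3 ρ v₀ (Equiv.swap (0 : Fin 3) 1) ![a 0 - 1, a 1 - 1] f₂ →
        ∀ Rγ Rω R₁ R₂ : Finset (GG p 3),
          IsRepSet p 3 (gammaGL p 3) Rγ → IsRepSet p 3 (permGL p 3 (Equiv.swap (0 : Fin 3) 1)) Rω →
          IsRepSet p 3 (tGL p 3 ![0, -1]) R₁ → IsRepSet p 3 (tGL p 3 ![-1, -1]) R₂ →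
          (hk p 3 (gammaGL p 3) Rγ (hk p 3 (permGL p 3 (Equiv.swap (0 : Fin 3) 1)) Rω (hk p 3 (gammaGL p 3) Rγ (hk p 3 (permGL p 3 (Equiv.swap (0 : Fin 3) 1)) Rω (f)))) = f₁ ∧
           hk p 3 (tGL p 3 ![0, -1]) R₁ f = f₁ ∧
           hk p 3 (gammaGL p 3) Rγ (hk p 3 (permGL p 3 (Equiv.swap (0 : Fin 3) 1)) Rω (hk p 3 (gammaGL p 3) Rγ (hk p 3 (gammaGL p 3) Rγ (hk p 3 (permGL p 3 (Equiv.swap (0 : Fin 3) 1)) Rω (hk p 3 (gammaGL p 3) Rγ (f)))))) = f₂ ∧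
           hk p 3 (tGL p 3 ![-1, -1]) R₂ f = f₂)) ∧
    (∀ a : Fin 2 → ℤ, a ∈ Sset p 3 ((Equiv.swap (0 : Fin 3) 1) * w2 3) →
      ∀ f f₁ f₂ : GG p 3 → V,
        IsStd p 3 ρ v₀ ((Equiv.swap (0 : Fin 3) 1) * w2 3) a f →
        IsStd p 3 ρ v₀ ((Equiv.swap (0 : Fin 3) 1) * w2 3) ![a 0 + 1, a 1] f₁ →
        IsStd p 3 ρ v₀ ((Equiv.swap (0 : Fin 3) 1) * w2 3) ![a 0 + 1, a 1 + 1] f₂ →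
        ∀ Rγ Rω R₁ R₂ : Finset (GG p 3),
          IsRepSet p 3 (gammaGL p 3) Rγ → IsRepSet p 3 (permGL p 3 (Equiv.swap (0 : Fin 3) 1)) Rω →
          IsRepSet p 3 (tGL p 3 ![1, 0]) R₁ → IsRepSet p 3 (tGL p 3 ![1, 1]) R₂ →
          (hk p 3 (gammaGL p 3) Rγ (hk p 3 (gammaGL p 3) Rγ (hk p 3 (permGL p 3 (Equiv.swap (0 : Fin 3) 1)) Rω (hk p 3 (gammaGL p 3) Rγ (hk p 3 (gammaGL p 3) Rγ (hk p 3 (permGL p 3 (Equiv.swap (0 : Fin 3) 1)) Rω (f)))))) = f₁ ∧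
           hk p 3 (tGL p 3 ![1, 0]) R₁ f = f₁ ∧
           hk p 3 (gammaGL p 3) Rγ (hk p 3 (gammaGL p 3) Rγ (hk p 3 (permGL p 3 (Equiv.swap (0 : Fin 3) 1)) Rω (hk p 3 (gammaGL p 3) Rγ (hk p 3 (gammaGL p 3) Rγ (hk p 3 (gammaGL p 3) Rγ (hk p 3 (gammaGL p 3) Rγ (hk p 3 (permGL p 3 (Equiv.swap (0 : Fin 3) 1)) Rω (hk p 3 (gammaGL p 3) Rγ (hk p 3 (gammaGL p 3) Rγ (f)))))))))) = f₂ ∧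
           hk p 3 (tGL p 3 ![1, 1]) R₂ f = f₂)) ∧
    (∀ a : Fin 2 → ℤ, a ∈ Sset p 3 (w2 3 * (Equiv.swap (0 : Fin 3) 1)) →
      ∀ f f₁ f₂ : GG p 3 → V,
        IsStd p 3 ρ v₀ (w2 3 * (Equiv.swap (0 : Fin 3) 1)) a f →
        IsStd p 3 ρ v₀ (w2 3 * (Equiv.swap (0 : Fin 3) 1)) ![a 0 - 1, a 1] f₁ →
        IsStd p 3 ρ v₀ (w2 3 * (Equiv.swap (0 : Fin 3) 1)) ![a 0, a 1 + 1] f₂ →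
        ∀ Rγ Rω R₁ R₂ : Finset (GG p 3),
          IsRepSet p 3 (gammaGL p 3) Rγ → IsRepSet p 3 (permGL p 3 (Equiv.swap (0 : Fin 3) 1)) Rω →
          IsRepSet p 3 (tGL p 3 ![-1, 0]) R₁ → IsRepSet p 3 (tGL p 3 ![0, 1]) R₂ →
          (hk p 3 (permGL p 3 (Equiv.swap (0 : Fin 3) 1)) Rω (hk p 3 (gammaGL p 3) Rγ (hk p 3 (permGL p 3 (Equiv.swap (0 : Fin 3) 1)) Rω (hk p 3 (gammaGL p 3) Rγ (f)))) = f₁ ∧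
           hk p 3 (tGL p 3 ![-1, 0]) R₁ f = f₁ ∧
           hk p 3 (permGL p 3 (Equiv.swap (0 : Fin 3) 1)) Rω (hk p 3 (gammaGL p 3) Rγ (hk p 3 (gammaGL p 3) Rγ (hk p 3 (permGL p 3 (Equiv.swap (0 : Fin 3) 1)) Rω (hk p 3 (gammaGL p 3) Rγ (hk p 3 (gammaGL p 3) Rγ (f)))))) = f₂ ∧
           hk p 3 (tGL p 3 ![0, 1]) R₂ f = f₂)) ∧
    (∀ a : Fin 2 → ℤ, a ∈ Sset p 3 (w2 3) →
      ∀ f f₁ f₂ : GG p 3 → V,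
        IsStd p 3 ρ v₀ (w2 3) a f →
        IsStd p 3 ρ v₀ (w2 3) ![a 0 + 1, a 1] f₁ →
        IsStd p 3 ρ v₀ (w2 3) ![a 0, a 1 - 1] f₂ →
        ∀ Rγ Rω R₁ R₂ : Finset (GG p 3),
          IsRepSet p 3 (gammaGL p 3) Rγ → IsRepSet p 3 (permGL p 3 (Equiv.swap (0 : Fin 3) 1)) Rω →
          IsRepSet p 3 (tGL p 3 ![1, 0]) R₁ → IsRepSet p 3 (tGL p 3 ![0, -1]) R₂ →
          (hk p 3 (gammaGL p 3) Rγ (hk p 3 (gammaGL p 3) Rγ (hk p 3 (permGL p 3 (Equiv.swap (0 : Fin 3) 1)) Rω (hk p 3 (gammaGL p 3) Rγ (hk p 3 (gammaGL p 3) Rγ (hk p 3 (permGL p 3 (Equiv.swap (0 : Fin 3) 1)) Rω (f)))))) = f₁ ∧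
           hk p 3 (tGL p 3 ![1, 0]) R₁ f = f₁ ∧
           hk p 3 (gammaGL p 3) Rγ (hk p 3 (permGL p 3 (Equiv.swap (0 : Fin 3) 1)) Rω (hk p 3 (gammaGL p 3) Rγ (hk p 3 (permGL p 3 (Equiv.swap (0 : Fin 3) 1)) Rω (f)))) = f₂ ∧
           hk p 3 (tGL p 3 ![0, -1]) R₂ f = f₂)) ∧
    (∀ a : Fin 2 → ℤ, a ∈ Sset p 3 (w2 3 * w2 3) →
      ∀ f f₁ f₂ : GG p 3 → V,
        IsStd p 3 ρ v₀ (w2 3 * w2 3) a f →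
        IsStd p 3 ρ v₀ (w2 3 * w2 3) ![a 0, a 1 + 1] f₁ →
        IsStd p 3 ρ v₀ (w2 3 * w2 3) ![a 0 + 1, a 1 + 1] f₂ →
        ∀ Rγ Rω R₁ R₂ : Finset (GG p 3),
          IsRepSet p 3 (gammaGL p 3) Rγ → IsRepSet p 3 (permGL p 3 (Equiv.swap (0 : Fin 3) 1)) Rω →
          IsRepSet p 3 (tGL p 3 ![0, 1]) R₁ → IsRepSet p 3 (tGL p 3 ![1, 1]) R₂ →
          (hk p 3 (permGL p 3 (Equiv.swap (0 : Fin 3) 1)) Rω (hk p 3 (gammaGL p 3) Rγ (hk p 3 (gammaGL p 3) Rγ (hk p 3 (permGL p 3 (Equiv.swap (0 : Fin 3) 1)) Rω (hk p 3 (gammaGL p 3) Rγ (hk p 3 (gammaGL p 3) Rγ (f)))))) = f₁ ∧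
           hk p 3 (tGL p 3 ![0, 1]) R₁ f = f₁ ∧
           hk p 3 (gammaGL p 3) Rγ (hk p 3 (gammaGL p 3) Rγ (hk p 3 (permGL p 3 (Equiv.swap (0 : Fin 3) 1)) Rω (hk p 3 (gammaGL p 3) Rγ (hk p 3 (gammaGL p 3) Rγ (hk p 3 (gammaGL p 3) Rγ (hk p 3 (gammaGL p 3) Rγ (hk p 3 (permGL p 3 (Equiv.swap (0 : Fin 3) 1)) Rω (hk p 3 (gammaGL p 3) Rγ (hk p 3 (gammaGL p 3) Rγ (f)))))))))) = f₂ ∧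
           hk p 3 (tGL p 3 ![1, 1]) R₂ f = f₂)) := by
  refine ⟨?_, ?_, ?_, ?_, ?_, ?_⟩ <;> intro a ha f f₁ f₂ hf hf₁ hf₂ Rγ Rω R₁ R₂ hγ hω h₁ h₂
  · have b10 := Sset_lt ha (i := 1) (j := 0) (by decide)
    have b21 := Sset_lt ha (i := 2) (j := 1) (by decide)
    simp at b10 b21
    have H₁ :=
      hf.std.reach |>.gamma hγ |>.swap hω (by simp; omega) |>.gamma hγ
        |>.swap hω (by simp; omega)
    have EH₁ := H₁.eq hf hf₁ h₁ (by decide) (by simp) (by simp)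
      (by simp) (by simp)
    have H₂ :=
      hf.std.reach |>.gamma hγ |>.swap hω (by simp; omega) |>.gamma hγ |>.gamma hγ
        |>.swap hω (by simp; omega) |>.gamma hγ
    have EH₂ := H₂.eq hf hf₂ h₂ (by decide) (by simp) (by simp)
      (by simp) (by simp)
    exact ⟨EH₁.1, EH₁.2, EH₂.1, EH₂.2⟩
  · have b01 := Sset_lt ha (i := 0) (j := 1) (by decide)
    have b20 := Sset_lt ha (i := 2) (j := 0) (by decide)
    simp at b01 b20
    have H₁ :=
      hf.std.reach |>.swap hω (by simp; omega) |>.gamma hγ |>.swap hω (by simp; omega)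
        |>.gamma hγ
    have EH₁ := H₁.eq hf hf₁ h₁ (by decide) (by simp) (by simp)
      (by simp) (by simp)
    have H₂ :=
      hf.std.reach |>.gamma hγ |>.swap hω (by simp; omega) |>.gamma hγ |>.gamma hγ
        |>.swap hω (by simp; omega) |>.gamma hγ
    have EH₂ := H₂.eq hf hf₂ h₂ (by decide) (by simp) (by simp)
      (by simp) (by simp)
    exact ⟨EH₁.1, EH₁.2, EH₂.1, EH₂.2⟩
  · have b01 := Sset_lt ha (i := 0) (j := 1) (by decide)
    have b12 := Sset_lt ha (i := 1) (j := 2) (by decide)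
    simp at b01 b12
    have H₁ :=
      hf.std.reach |>.swap hω (by simp; omega) |>.gamma hγ |>.gamma hγ
        |>.swap hω (by simp; omega) |>.gamma hγ |>.gamma hγ
    have EH₁ := H₁.eq hf hf₁ h₁ (by decide) (by simp) (by simp)
      (by simp) (by simp)
    have H₂ :=
      hf.std.reach |>.gamma hγ |>.gamma hγ |>.swap hω (by simp; omega) |>.gamma hγ
        |>.gamma hγ |>.gamma hγ |>.gamma hγ |>.swap hω (by simp; omega) |>.gamma hγ
        |>.gamma hγ
    have EH₂ := H₂.eq hf hf₂ h₂ (by set_option maxRecDepth 2000 in decide) (by simp) (by simp)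
      (by simp) (by simp)
    exact ⟨EH₁.1, EH₁.2, EH₂.1, EH₂.2⟩
  · have b12 := Sset_lt ha (i := 1) (j := 2) (by decide)
    have b20 := Sset_lt ha (i := 2) (j := 0) (by decide)
    simp at b12 b20
    have H₁ :=
      hf.std.reach |>.gamma hγ |>.swap hω (by simp; omega) |>.gamma hγ
        |>.swap hω (by simp; omega)
    have EH₁ := H₁.eq hf hf₁ h₁ (by decide) (by simp) (by simp)
      (by simp) (by simp)
    have H₂ :=
      hf.std.reach |>.gamma hγ |>.gamma hγ |>.swap hω (by simp; omega) |>.gamma hγ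
        |>.gamma hγ |>.swap hω (by simp; omega)
    have EH₂ := H₂.eq hf hf₂ h₂ (by decide) (by simp) (by simp)
      (by simp) (by simp)
    exact ⟨EH₁.1, EH₁.2, EH₂.1, EH₂.2⟩
  · have b02 := Sset_lt ha (i := 0) (j := 2) (by decide)
    have b21 := Sset_lt ha (i := 2) (j := 1) (by decide)
    simp at b02 b21
    have H₁ :=
      hf.std.reach |>.swap hω (by simp; omega) |>.gamma hγ |>.gamma hγ
        |>.swap hω (by simp; omega) |>.gamma hγ |>.gamma hγ
    have EH₁ := H₁.eq hf hf₁ h₁ (by decide) (by simp) (by simp)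
      (by simp) (by simp)
    have H₂ :=
      hf.std.reach |>.swap hω (by simp; omega) |>.gamma hγ |>.swap hω (by simp; omega)
        |>.gamma hγ
    have EH₂ := H₂.eq hf hf₂ h₂ (by decide) (by simp) (by simp)
      (by simp) (by simp)
    exact ⟨EH₁.1, EH₁.2, EH₂.1, EH₂.2⟩
  · have b02 := Sset_lt ha (i := 0) (j := 2) (by decide)
    have b10 := Sset_lt ha (i := 1) (j := 0) (by decide)
    simp at b02 b10
    have H₁ :=
      hf.std.reach |>.gamma hγ |>.gamma hγ |>.swap hω (by simp; omega) |>.gamma hγ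
        |>.gamma hγ |>.swap hω (by simp; omega)
    have EH₁ := H₁.eq hf hf₁ h₁ (by decide) (by simp) (by simp)
      (by simp) (by simp)
    have H₂ :=
      hf.std.reach |>.gamma hγ |>.gamma hγ |>.swap hω (by simp; omega) |>.gamma hγ
        |>.gamma hγ |>.gamma hγ |>.gamma hγ |>.swap hω (by simp; omega) |>.gamma hγ
        |>.gamma hγ
    have EH₂ := H₂.eq hf hf₂ h₂ (by set_option maxRecDepth 2000 in decide) (by simp) (by simp)
      (by simp) (by simp)
    exact ⟨EH₁.1, EH₁.2, EH₂.1, EH₂.2⟩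

end IH
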